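/- arXiv:1701.02874 — 4 statements merged into one kernel-verified Lean document; each statement's English description precedes it below -/
import Mathlib

section
/- Let f : ℝ^m → ℝ be differentiable with gradient f' and let x* ∈ D admit a weight vector u*. If for all indices i, j ∈ I the implication u*_i > 0 ⟹ ⟨f'(x*), z^i⟩ ≤ ⟨f'(x*), z^j⟩ holds, then x* solves the variational inequality: ⟨f'(x*), x − x*⟩ ≥ 0 for all x ∈ D. -/
open RealInnerProductSpace Finset

/-- Proposition 2.1, condition (2.9) implies the VI: if for all i, j ∈ I,
u*_i > 0 ⟹ ⟨f'(x*), z^i⟩ ≤ ⟨f'(x*), z^j⟩, then x* solves the variational inequality. -/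
theorem stmt_5 {m n : ℕ} (z : Fin n → EuclideanSpace ℝ (Fin m))
    (D : Set (EuclideanSpace ℝ (Fin m))) (hD : D = convexHull ℝ (Set.range z))
    (f : EuclideanSpace ℝ (Fin m) → ℝ) (f' : EuclideanSpace ℝ (Fin m) → EuclideanSpace ℝ (Fin m))
    (hf : ∀ x, HasGradientAt f (f' x) x)
    (xs : EuclideanSpace ℝ (Fin m)) (hxs : xs ∈ D)
    (us : Fin n → ℝ) (hnn : ∀ i, 0 ≤ us i) (hsum : ∑ i, us i = 1)
    (hrep : xs = ∑ i, us i • z i)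
    (hcond : ∀ i j, 0 < us i → ⟪f' xs, z i⟫ ≤ ⟪f' xs, z j⟫) :
    ∀ x ∈ D, 0 ≤ ⟪f' xs, x - xs⟫ := by
  have hle (j : Fin n) : ⟪f' xs, xs⟫ ≤ ⟪f' xs, z j⟫ := by
    calc ⟪f' xs, xs⟫ = ⟪f' xs, ∑ i, us i • z i⟫ := congrArg _ hrep
      _ = ∑ i, us i * ⟪f' xs, z i⟫ := by simp only [inner_sum, real_inner_smul_right]
      _ ≤ ∑ i, us i * ⟪f' xs, z j⟫ := by
        refine Finset.sum_le_sum fun i _ => ?_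
        rcases (hnn i).eq_or_lt with h | h
        · simp [← h]
        · exact mul_le_mul_of_nonneg_left (hcond i j h) h.le
      _ = ⟪f' xs, z j⟫ := by rw [← Finset.sum_mul, hsum, one_mul]
  have hconv : Convex ℝ {x | ⟪f' xs, xs⟫ ≤ ⟪f' xs, x⟫} :=
    convex_halfSpace_ge (innerSL ℝ (f' xs)).toLinearMap.isLinear _
  intro x hx
  rw [inner_sub_right, sub_nonneg]
  rw [hD] at hx
  have hrange : Set.range z ⊆ {x | ⟪f' xs, xs⟫ ≤ ⟪f' xs, x⟫} := Set.range_subset_iff.2 hle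
  exact convexHull_min hrange hconv hx
end

section
/- Let f : ℝ^m → ℝ be differentiable with gradient f' and let x* ∈ D admit a weight vector u*. If for all indices i, j ∈ I the implication ⟨f'(x*), z^i⟩ > ⟨f'(x*), z^j⟩ ⟹ u*_i = 0 holds, then x* solves the variational inequality: ⟨f'(x*), x − x*⟩ ≥ 0 for all x ∈ D. -/
open RealInnerProductSpace Finset

/-- Proposition 2.1, condition (2.8) implies the VI: if for all i, j ∈ I,
⟨f'(x*), z^i⟩ > ⟨f'(x*), z^j⟩ ⟹ u*_i = 0, then x* solves the variational inequality. -/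
theorem stmt_6 {m n : ℕ} (z : Fin n → EuclideanSpace ℝ (Fin m))
    (D : Set (EuclideanSpace ℝ (Fin m))) (hD : D = convexHull ℝ (Set.range z))
    (f : EuclideanSpace ℝ (Fin m) → ℝ) (f' : EuclideanSpace ℝ (Fin m) → EuclideanSpace ℝ (Fin m))
    (hf : ∀ x, HasGradientAt f (f' x) x)
    (xs : EuclideanSpace ℝ (Fin m)) (hxs : xs ∈ D)
    (us : Fin n → ℝ) (hnn : ∀ i, 0 ≤ us i) (hsum : ∑ i, us i = 1)
    (hrep : xs = ∑ i, us i • z i)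
    (hcond : ∀ i j, ⟪f' xs, z j⟫ < ⟪f' xs, z i⟫ → us i = 0) :
    ∀ x ∈ D, 0 ≤ ⟪f' xs, x - xs⟫ := by
  have hle : ∀ j, ⟪f' xs, xs⟫ ≤ ⟪f' xs, z j⟫ := by
    intro j
    calc ⟪f' xs, xs⟫ = ∑ i, us i * ⟪f' xs, z i⟫ := by
          conv_lhs => arg 3; rw [hrep]
          simp only [inner_sum, real_inner_smul_right]
      _ ≤ ∑ i, us i * ⟪f' xs, z j⟫ := by
          refine Finset.sum_le_sum fun i _ => ?_
          rcases le_or_gt ⟪f' xs, z i⟫ ⟪f' xs, z j⟫ with h | h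
          · exact mul_le_mul_of_nonneg_left h (hnn i)
          · simp [hcond i j h]
      _ = ⟪f' xs, z j⟫ := by rw [← Finset.sum_mul, hsum, one_mul]
  have hhull : convexHull ℝ (Set.range z) ⊆ {x | ⟪f' xs, xs⟫ ≤ ⟪f' xs, x⟫} :=
    convexHull_min (Set.range_subset_iff.2 hle)
      (convex_halfSpace_ge (innerₛₗ ℝ (f' xs)).isLinear _)
  intro x hx
  rw [inner_sub_right, sub_nonneg]
  exact hhull (hD ▸ hx)
end

section
/- Let f : ℝ^m → ℝ be differentiable with gradient f', let w ∈ D have weight vector v (so w = Σ_{s∈I} v_s z^s, Σ v_s = 1, v_s ≥ 0), let δ ≥ 0, ε ≥ 0, and let σ ≥ 0 satisfy |⟨f'(w), z^i⟩| ≤ σ for all i ∈ I. Suppose that ⟨f'(w), z^i − z^j⟩ ≤ δ for all i ∈ I with v_i ≥ ε and all j ∈ I. Then the gap value Δ(w) = max_{y ∈ D} ⟨f'(w), w − y⟩ satisfies Δ(w) ≤ δ + 2 n ε σ. -/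
open RealInnerProductSpace Finset

/-- A sum weighted by a probability vector is at most `δ + 2 * n * ε * σ` when its terms are at most
`2 * σ`, and at most `δ` where the weight is at least `ε`. -/
theorem sum_mul_le_of_le_of_weight_ge {n : ℕ} {v a : Fin n → ℝ} {δ ε σ : ℝ}
    (hv : ∀ i, 0 ≤ v i) (hsum : ∑ i, v i = 1) (hδ : 0 ≤ δ) (hε : 0 ≤ ε) (hσ : 0 ≤ σ)
    (ha : ∀ i, a i ≤ 2 * σ) (hδa : ∀ i, ε ≤ v i → a i ≤ δ) :
    ∑ i, v i * a i ≤ δ + 2 * n * ε * σ := by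
  have hterm : ∀ i, v i * a i ≤ v i * δ + ε * (2 * σ) := by
    intro i
    rcases le_or_gt ε (v i) with h | h
    · have h₁ := mul_le_mul_of_nonneg_left (hδa i h) (hv i)
      have h₂ : 0 ≤ ε * (2 * σ) := by positivity
      linarith
    · have h₁ := mul_le_mul_of_nonneg_left (ha i) (hv i)
      have h₂ : v i * (2 * σ) ≤ ε * (2 * σ) := by gcongr
      have h₃ := mul_nonneg (hv i) hδ
      linarith
  calc ∑ i, v i * a i ≤ ∑ i, (v i * δ + ε * (2 * σ)) := Finset.sum_le_sum fun i _ => hterm i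
    _ = δ + 2 * n * ε * σ := by
      rw [Finset.sum_add_distrib, ← Finset.sum_mul, hsum]
      simp
      ring

/-- Proposition 4.1: if w ∈ D has weight vector v and ⟨f'(w), z^i − z^j⟩ ≤ δ for all
i with v_i ≥ ε and all j, while |⟨f'(w), z^i⟩| ≤ σ for all i, then the gap value
Δ(w) = max_{y∈D} ⟨f'(w), w − y⟩ satisfies Δ(w) ≤ δ + 2nεσ. -/
theorem stmt_13 {m n : ℕ} (z : Fin n → EuclideanSpace ℝ (Fin m))
    (D : Set (EuclideanSpace ℝ (Fin m))) (hD : D = convexHull ℝ (Set.range z))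
    (f : EuclideanSpace ℝ (Fin m) → ℝ) (f' : EuclideanSpace ℝ (Fin m) → EuclideanSpace ℝ (Fin m))
    (hf : ∀ x, HasGradientAt f (f' x) x)
    (w : EuclideanSpace ℝ (Fin m)) (hw : w ∈ D)
    (v : Fin n → ℝ) (hnn : ∀ s, 0 ≤ v s) (hsum : ∑ s, v s = 1)
    (hrep : w = ∑ s, v s • z s)
    (δ ε σ : ℝ) (hδ : 0 ≤ δ) (hε : 0 ≤ ε) (hσ : 0 ≤ σ)
    (hbound : ∀ i, |⟪f' w, z i⟫| ≤ σ)
    (hcond : ∀ i j, ε ≤ v i → ⟪f' w, z i - z j⟫ ≤ δ) :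
    ∀ y ∈ D, ⟪f' w, w - y⟫ ≤ δ + 2 * n * ε * σ := by
  have hvertex : ∀ j, ⟪f' w, w - z j⟫ ≤ δ + 2 * n * ε * σ := by
    intro j
    have hexp : ⟪f' w, w - z j⟫ = ∑ i, v i * ⟪f' w, z i - z j⟫ := by
      have hw' : ⟪f' w, w⟫ = ∑ i, v i * ⟪f' w, z i⟫ := by
        conv_lhs => rw [show ⟪f' w, w⟫ = ⟪f' w, ∑ s, v s • z s⟫ from congrArg _ hrep]
        simp only [inner_sum, real_inner_smul_right]
      simp only [inner_sub_right, mul_sub, Finset.sum_sub_distrib, ← Finset.sum_mul, hsum, one_mul,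
        hw']
    rw [hexp]
    refine sum_mul_le_of_le_of_weight_ge hnn hsum hδ hε hσ (fun i => ?_) fun i => hcond i j
    rw [inner_sub_right]
    linarith [(abs_le.mp (hbound i)).2, (abs_le.mp (hbound j)).1]
  have hhull : convexHull ℝ (Set.range z) ⊆
      {y | ⟪f' w, w⟫ - (δ + 2 * n * ε * σ) ≤ ⟪f' w, y⟫} := by
    refine convexHull_min ?_ (convex_halfSpace_ge (innerₛₗ ℝ (f' w)).isLinear _)
    rintro _ ⟨j, rfl⟩
    have h := hvertex j
    rw [inner_sub_right] at h
    change ⟪f' w, w⟫ - (δ + 2 * n * ε * σ) ≤ ⟪f' w, z j⟫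
    linarith
  intro y hy
  have h : ⟪f' w, w⟫ - (δ + 2 * n * ε * σ) ≤ ⟪f' w, y⟫ := hhull (hD ▸ hy)
  rw [inner_sub_right]
  linarith
end

section
/- Let f : ℝ^m → ℝ be continuously differentiable with gradient f'. Let (w^l) be a sequence in D with associated weight vectors (v^l) (so w^l = Σ_{s∈I} v^l_s z^s, Σ_s v^l_s = 1, v^l_s ≥ 0), let (δ_l) and (ε_l) be sequences of positive reals converging to 0, and suppose that for every l and all i, j ∈ I with v^l_i ≥ ε_l one has ⟨f'(w^l), z^i − z^j⟩ ≤ δ_l. If w^l → w̄ and v^l → v̄ (componentwise), then w̄ solves the variational inequality: w̄ ∈ D and ⟨f'(w̄), x − w̄⟩ ≥ 0 for all x ∈ D. -/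
open RealInnerProductSpace Finset Filter Topology

/-- From the proof of Theorem 3.1: if w^l ∈ D have weight vectors v^l, the tolerances
δ_l, ε_l > 0 tend to 0, and ⟨f'(w^l), z^i − z^j⟩ ≤ δ_l for all i, j with v^l_i ≥ ε_l,
then any limit w̄ of (w^l) whose weight vectors converge to some v̄ solves the
variational inequality. -/
theorem stmt_14 {m n : ℕ} (z : Fin n → EuclideanSpace ℝ (Fin m))
    (D : Set (EuclideanSpace ℝ (Fin m))) (hD : D = convexHull ℝ (Set.range z))
    (f : EuclideanSpace ℝ (Fin m) → ℝ) (f' : EuclideanSpace ℝ (Fin m) → EuclideanSpace ℝ (Fin m))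
    (hf : ∀ x, HasGradientAt f (f' x) x) (hf' : Continuous f')
    (w : ℕ → EuclideanSpace ℝ (Fin m)) (v : ℕ → Fin n → ℝ)
    (hnn : ∀ l s, 0 ≤ v l s) (hsum : ∀ l, ∑ s, v l s = 1)
    (hrep : ∀ l, w l = ∑ s, v l s • z s)
    (δ ε : ℕ → ℝ) (hδpos : ∀ l, 0 < δ l) (hεpos : ∀ l, 0 < ε l)
    (hδ0 : Tendsto δ atTop (𝓝 0)) (hε0 : Tendsto ε atTop (𝓝 0))
    (hcond : ∀ l, ∀ i j : Fin n, ε l ≤ v l i → ⟪f' (w l), z i - z j⟫ ≤ δ l)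
    (wbar : EuclideanSpace ℝ (Fin m)) (hw : Tendsto w atTop (𝓝 wbar))
    (vbar : Fin n → ℝ) (hv : ∀ i, Tendsto (fun l => v l i) atTop (𝓝 (vbar i))) :
    wbar ∈ D ∧ ∀ x ∈ D, 0 ≤ ⟪f' wbar, x - wbar⟫ := by
  have hrepbar : wbar = ∑ s, vbar s • z s := by
    refine tendsto_nhds_unique hw ?_
    rw [funext hrep]
    exact tendsto_finsetSum _ fun i _ => (hv i).smul_const (z i)
  have hnnbar : ∀ i, 0 ≤ vbar i := fun i => ge_of_tendsto' (hv i) fun l => hnn l i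
  have hsumbar : ∑ i, vbar i = 1 := by
    refine tendsto_nhds_unique (tendsto_finsetSum univ fun i _ => hv i) ?_
    simp_rw [hsum]
    exact tendsto_const_nhds
  have hinner : ∀ i j, 0 < vbar i → ⟪f' wbar, z i - z j⟫ ≤ 0 := by
    intro i j hi
    have hlim : Tendsto (fun l => ⟪f' (w l), z i - z j⟫) atTop (𝓝 ⟪f' wbar, z i - z j⟫) :=
      ((hf'.tendsto wbar).comp hw).inner tendsto_const_nhds
    refine le_of_tendsto_of_tendsto hlim hδ0 ?_
    filter_upwards [hε0.eventually_lt (hv i) hi] with l hl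
    exact hcond l i j hl.le
  have hvertex : ∀ j, ⟪f' wbar, wbar⟫ ≤ ⟪f' wbar, z j⟫ := by
    intro j
    calc ⟪f' wbar, wbar⟫ = ∑ i, vbar i * ⟪f' wbar, z i⟫ := by
          conv_lhs => rw [hrepbar, inner_sum, ← hrepbar]
          simp_rw [real_inner_smul_right]
      _ ≤ ∑ i, vbar i * ⟪f' wbar, z j⟫ := by
          refine sum_le_sum fun i _ => ?_
          rcases (hnnbar i).eq_or_lt with h | h
          · simp [← h]
          · refine mul_le_mul_of_nonneg_left ?_ h.le
            have := hinner i j h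
            rwa [inner_sub_right, sub_nonpos] at this
      _ = ⟪f' wbar, z j⟫ := by rw [← sum_mul, hsumbar, one_mul]
  subst hD
  constructor
  · rw [hrepbar]
    exact (convex_convexHull ℝ _).sum_mem (fun i _ => hnnbar i) hsumbar
      fun i _ => subset_convexHull ℝ _ (Set.mem_range_self i)
  · intro x hx
    have hsub : convexHull ℝ (Set.range z) ⊆ {x | ⟪f' wbar, wbar⟫ ≤ innerSL ℝ (f' wbar) x} :=
      convexHull_min (Set.range_subset_iff.2 hvertex)
        (convex_halfSpace_ge (innerSL ℝ (f' wbar)).toLinearMap.isLinear _)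
    rw [inner_sub_right, sub_nonneg]
    exact hsub hx
end
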